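/- For every matrix E∈M₂(ℤ) with |det E| ≥ 2 and every ε > 0 there exists a C^∞ local diffeomorphism g:𝕋²→𝕋² such that: g is homotopic to the linear endomorphism of 𝕋² induced by E; g preserves Lebesgue (Haar) measure on 𝕋²; the Jacobian of g is not constant, i.e. |det Dg_p| ≠ |det E| for some p∈𝕋²; and g is C¹-ε-close to E, i.e. sup_x d(g(x), Ex) < ε and sup_x ‖Dg_x − E‖ < ε. -/

import Mathlib

open MeasureTheory Set
open scoped ENNReal NNReal

noncomputable section

instance fact_zero_lt_one' : Fact ((0:ℝ) < 1) := ⟨one_pos⟩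

/-- The plane `ℝ²` with the Euclidean norm: the universal cover of the 2-torus. -/
abbrev V2 : Type := EuclideanSpace ℝ (Fin 2)

/-- The flat 2-torus `𝕋² = ℝ²/ℤ²`. -/
abbrev T2 : Type := AddCircle (1 : ℝ) × AddCircle (1 : ℝ)

/-- The covering projection `ℝ² → 𝕋²`. -/
def proj (p : V2) : T2 := (↑(p 0), ↑(p 1))

/-- The integer vector `(m 0, m 1)` as an element of the plane. -/
def iv (m : Fin 2 → ℤ) : V2 := (WithLp.equiv 2 (Fin 2 → ℝ)).symm (fun i => (m i : ℝ))

/-- The linear map of the plane induced by an integer matrix. -/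
def matCLM (E : Matrix (Fin 2) (Fin 2) ℤ) : V2 →L[ℝ] V2 :=
  LinearMap.toContinuousLinearMap (Matrix.toEuclideanLin (E.map (Int.cast : ℤ → ℝ)))

/-- The explicit circle diffeomorphism lift. -/
def psi (η t : ℝ) : ℝ := t + η / (2 * Real.pi) * Real.sin (2 * Real.pi * t)

lemma psi_hasDerivAt (η t : ℝ) :
    HasDerivAt (psi η) (1 + η * Real.cos (2 * Real.pi * t)) t := by
  have h1 : HasDerivAt (fun t : ℝ => 2 * Real.pi * t) (2 * Real.pi) t := by
    simpa using (hasDerivAt_id t).const_mul (2 * Real.pi)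
  have h2 := (hasDerivAt_id t).add ((h1.sin).const_mul (η / (2 * Real.pi)))
  refine h2.congr_deriv ?_
  have := Real.pi_pos
  field_simp

lemma psi_deriv_pos {η : ℝ} (h0 : 0 < η) (h1 : η ≤ 1 / 2) (t : ℝ) :
    1 / 2 ≤ 1 + η * Real.cos t := by
  nlinarith [Real.neg_one_le_cos t]

lemma psi_strictMono {η : ℝ} (h0 : 0 < η) (h1 : η ≤ 1 / 2) : StrictMono (psi η) := by
  apply strictMono_of_deriv_pos
  intro t
  rw [(psi_hasDerivAt η t).deriv]
  linarith [psi_deriv_pos h0 h1 (2 * Real.pi * t)]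

lemma psi_sub_le {η : ℝ} (h0 : 0 < η) (t : ℝ) : |psi η t - t| ≤ η := by
  have h3 := Real.pi_gt_three
  have h : psi η t - t = η / (2 * Real.pi) * Real.sin (2 * Real.pi * t) := by simp [psi]
  rw [h, abs_mul, abs_of_pos (by positivity)]
  have h4 := Real.abs_sin_le_one (2 * Real.pi * t)
  have h5 : η / (2 * Real.pi) ≤ η := div_le_self h0.le (by linarith)
  calc _ ≤ η * 1 := by gcongr
    _ = η := mul_one η

lemma psi_contDiff (η : ℝ) : ContDiff ℝ (⊤ : ℕ∞) (psi η) := by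
  unfold psi
  fun_prop

lemma psi_surjective {η : ℝ} (h0 : 0 < η) : Function.Surjective (psi η) := by
  apply (psi_contDiff η).continuous.surjective
  · refine Filter.tendsto_atTop_mono (f := fun t => t - η) ?_ ?_
    · intro t
      have := (abs_le.1 (psi_sub_le h0 t)).1
      linarith
    · exact Filter.tendsto_atTop_add_const_right _ _ Filter.tendsto_id
  · refine Filter.tendsto_atBot_mono (f := fun t => t + η) ?_ ?_
    · intro t
      have := (abs_le.1 (psi_sub_le h0 t)).2
      linarith
    · exact Filter.tendsto_atBot_add_const_right _ _ Filter.tendsto_id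

lemma psi_add_one (η t : ℝ) : psi η (t + 1) = psi η t + 1 := by
  unfold psi
  rw [mul_add, mul_one, Real.sin_add_two_pi]; ring

lemma exists_tau {η : ℝ} (h0 : 0 < η) (h1 : η ≤ 1 / 2) :
    ∃ τ : ℝ → ℝ, ContDiff ℝ (⊤ : ℕ∞) τ ∧ (∀ t, psi η (τ t) = t) ∧ (∀ t, τ (psi η t) = t) ∧
      (∀ t, τ (t + 1) = τ t + 1) ∧
      (∀ t, HasDerivAt τ (1 + η * Real.cos (2 * Real.pi * τ t))⁻¹ t) := by
  let e := ((psi_strictMono h0 h1).orderIsoOfSurjective _ (psi_surjective h0)).toHomeomorph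
  have he : (e : ℝ → ℝ) = psi η := rfl
  have hne : ∀ t, 1 + η * Real.cos (2 * Real.pi * t) ≠ 0 := fun t => by
    linarith [psi_deriv_pos h0 h1 (2 * Real.pi * t)]
  have hr : ∀ t, psi η (e.symm t) = t := fun t => e.apply_symm_apply t
  have hl : ∀ t, e.symm (psi η t) = t := fun t => e.symm_apply_apply t
  have hc : ContDiff ℝ (⊤ : ℕ∞) e.symm :=
    e.contDiff_symm_deriv hne (fun t => psi_hasDerivAt η t) (psi_contDiff η)
  refine ⟨e.symm, hc, hr, hl, ?_, ?_⟩
  · intro t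
    apply (psi_strictMono h0 h1).injective
    rw [hr, psi_add_one, hr]
  · intro t
    exact HasDerivAt.of_local_left_inverse hc.continuous.continuousAt
      (psi_hasDerivAt η _) (hne _) (Filter.Eventually.of_forall hr)

/-- The density on the circle. -/
def wden (η : ℝ) (x : AddCircle (1 : ℝ)) : ℝ := 1 + η * (AddCircle.toCircle x : ℂ).re

lemma wden_continuous (η : ℝ) : Continuous (wden η) := by
  unfold wden
  have := AddCircle.continuous_toCircle (T := (1 : ℝ))
  fun_prop

lemma wden_coe (η t : ℝ) : wden η (t : AddCircle (1 : ℝ)) = 1 + η * Real.cos (2 * Real.pi * t) := by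
  unfold wden
  rw [AddCircle.toCircle_apply_mk, Circle.coe_exp, Complex.exp_ofReal_mul_I_re]
  simp

lemma circle_map {η : ℝ} (h0 : 0 < η) (h1 : η ≤ 1 / 2) {τ : ℝ → ℝ}
    (hr : ∀ t, psi η (τ t) = t) (hl : ∀ t, τ (psi η t) = t)
    {φ : AddCircle (1 : ℝ) → AddCircle (1 : ℝ)} (hφm : Measurable φ)
    (hφ : ∀ t : ℝ, φ (t : AddCircle (1 : ℝ)) = ((τ t : ℝ) : AddCircle (1 : ℝ))) :
    Measure.map φ volume =
      (volume : Measure (AddCircle (1 : ℝ))).withDensity (fun x => ENNReal.ofReal (wden η x)) := by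
  have hw : Measurable fun x => ENNReal.ofReal (wden η x) :=
    (wden_continuous η).measurable.ennreal_ofReal
  ext B hB
  rw [Measure.map_apply hφm hB, withDensity_apply _ hB, ← lintegral_indicator_one (hφm hB),
    ← lintegral_indicator hB, ← AddCircle.lintegral_preimage 1 0, ← AddCircle.lintegral_preimage 1 0]
  have himg : psi η '' Ioc 0 (0 + 1) = Ioc 0 (0 + 1) := by
    have p0 : psi η 0 = 0 := by simp [psi]
    have p1 : psi η (0 + 1) = 0 + 1 := by rw [psi_add_one, p0]
    have hm := psi_strictMono h0 h1
    ext y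
    constructor
    · rintro ⟨x, hx, rfl⟩
      exact ⟨p0 ▸ hm hx.1, p1 ▸ hm.monotone hx.2⟩
    · intro hy
      refine ⟨τ y, ⟨?_, ?_⟩, hr y⟩
      · rw [← hm.lt_iff_lt, p0, hr]; exact hy.1
      · rw [← hm.le_iff_le, p1, hr]; exact hy.2
  conv_lhs => rw [← himg]
  rw [lintegral_image_eq_lintegral_abs_deriv_mul measurableSet_Ioc
    (fun x _ => (psi_hasDerivAt η x).hasDerivWithinAt) (psi_strictMono h0 h1).injective.injOn]
  refine lintegral_congr fun t => ?_
  rw [abs_of_pos (by linarith [psi_deriv_pos h0 h1 (2 * Real.pi * t)])]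
  by_cases hB' : (t : AddCircle (1 : ℝ)) ∈ B
  · rw [indicator_of_mem hB', indicator_of_mem, wden_coe]
    · simp
    · simpa [hφ, hl] using hB'
  · rw [indicator_of_notMem hB', indicator_of_notMem]
    · simp
    · simpa [hφ, hl] using hB'

/-- The torus endomorphism. -/
def torusHom (E : Matrix (Fin 2) (Fin 2) ℤ) : T2 →+ T2 where
  toFun x := (E 0 0 • x.1 + E 0 1 • x.2, E 1 0 • x.1 + E 1 1 • x.2)
  map_zero' := by simp
  map_add' x y := by
    simp only [Prod.fst_add, Prod.snd_add, smul_add, Prod.mk_add_mk, Prod.mk.injEq]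
    constructor <;> abel

lemma torusHom_apply (E : Matrix (Fin 2) (Fin 2) ℤ) (x : T2) :
    torusHom E x = (E 0 0 • x.1 + E 0 1 • x.2, E 1 0 • x.1 + E 1 1 • x.2) := rfl

lemma torusHom_continuous (E : Matrix (Fin 2) (Fin 2) ℤ) : Continuous (torusHom E) := by
  simp only [torusHom, AddMonoidHom.coe_mk, ZeroHom.coe_mk]
  have h (n : ℤ) : Continuous fun x : AddCircle (1 : ℝ) => n • x := continuous_zsmul n
  refine Continuous.prodMk ?_ ?_ <;>
  exact ((h _).comp continuous_fst).add ((h _).comp continuous_snd)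

lemma proj_surjective : Function.Surjective proj := by
  rintro ⟨x, y⟩
  induction x using QuotientAddGroup.induction_on with | _ a
  induction y using QuotientAddGroup.induction_on with | _ b
  exact ⟨!₂[a, b], rfl⟩

lemma matCLM_apply (E : Matrix (Fin 2) (Fin 2) ℤ) (p : V2) (i : Fin 2) :
    matCLM E p i = E i 0 * p 0 + E i 1 * p 1 := by
  fin_cases i <;> simp [matCLM, Matrix.toLpLin_apply]

lemma torusHom_proj (E : Matrix (Fin 2) (Fin 2) ℤ) (p : V2) :
    torusHom E (proj p) = proj (matCLM E p) := by
  simp only [torusHom_apply, proj, matCLM_apply]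
  rw [← AddCircle.coe_zsmul, ← AddCircle.coe_zsmul, ← AddCircle.coe_zsmul, ← AddCircle.coe_zsmul,
    ← AddCircle.coe_add, ← AddCircle.coe_add]
  simp only [zsmul_eq_mul]

lemma torusHom_surjective {E : Matrix (Fin 2) (Fin 2) ℤ} (hE : E.det ≠ 0) :
    Function.Surjective (torusHom E) := by
  intro y
  obtain ⟨q, rfl⟩ := proj_surjective y
  have hd : (E.det : ℝ) ≠ 0 := by exact_mod_cast hE
  refine ⟨proj !₂[(E 1 1 * q 0 - E 0 1 * q 1) / E.det, (E 0 0 * q 1 - E 1 0 * q 0) / E.det], ?_⟩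
  rw [torusHom_proj]
  congr 1
  have hD : (E.det : ℝ) = E 0 0 * E 1 1 - E 0 1 * E 1 0 := by
    rw [Matrix.det_fin_two]; push_cast; rfl
  generalize (E.det : ℝ) = D at hd hD
  ext i
  fin_cases i <;> simp [matCLM_apply] <;> field_simp <;> rw [hD] <;> ring

instance haarT2 : (volume : Measure T2).IsAddHaarMeasure := by
  rw [Measure.volume_eq_prod]; infer_instance

lemma torusHom_mp {E : Matrix (Fin 2) (Fin 2) ℤ} (hE : E.det ≠ 0) :
    MeasurePreserving (torusHom E) volume volume :=
  AddMonoidHom.measurePreserving (torusHom_continuous E) (torusHom_surjective hE) rfl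

/-- coordinate on the torus -/
def coord (i : Fin 2) (x : T2) : AddCircle (1 : ℝ) := if i = 0 then x.1 else x.2

lemma coord_continuous (i : Fin 2) : Continuous (coord i) := by
  fin_cases i
  · exact continuous_fst
  · exact continuous_snd

lemma coord_add (i : Fin 2) (x y : T2) : coord i (x + y) = coord i x + coord i y := by
  fin_cases i <;> rfl

lemma coord_proj (i : Fin 2) (p : V2) : coord i (proj p) = (p i : ℝ) := by
  fin_cases i <;> rfl

lemma exists_adj (E : Matrix (Fin 2) (Fin 2) ℤ) (hE : 2 ≤ E.det.natAbs) :
    ∃ i j, ¬ E.det ∣ E.adjugate i j := by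
  by_contra! h
  choose f hf using h
  have h1 : E.adjugate = E.det • Matrix.of f := by
    ext i j; simp [hf]
  have h2 := Matrix.mul_adjugate E
  have h3 := congrArg Matrix.det h2
  rw [h1, Matrix.det_mul, Matrix.det_smul, Matrix.det_smul, Matrix.det_one] at h3
  simp only [Fintype.card_fin, mul_one] at h3
  have hd : E.det ≠ 0 := by intro h; simp [h] at hE
  have h4 : E.det * (Matrix.of f).det = 1 := by
    have : E.det ^ 2 * (E.det * (Matrix.of f).det) = E.det ^ 2 * 1 := by linarith
    exact mul_left_cancel₀ (pow_ne_zero 2 hd) this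
  have h5 := Int.isUnit_iff_natAbs_eq.1 (IsUnit.of_mul_eq_one _ h4)
  omega

lemma exists_ker (E : Matrix (Fin 2) (Fin 2) ℤ) (hE : 2 ≤ E.det.natAbs) :
    ∃ (i : Fin 2) (k : T2), torusHom E k = 0 ∧ coord i k ≠ 0 := by
  obtain ⟨i, j, hij⟩ := exists_adj E hE
  have hd : E.det ≠ 0 := by intro h; simp [h] at hE
  have hd' : (E.det : ℝ) ≠ 0 := by exact_mod_cast hd
  have hcoe (n : ℤ) : ((n : ℝ) : AddCircle (1 : ℝ)) = 0 := by
    rw [AddCircle.coe_eq_zero_iff]; exact ⟨n, by simp⟩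
  refine ⟨i, proj !₂[E.adjugate 0 j / E.det, E.adjugate 1 j / E.det], ?_, ?_⟩
  · rw [torusHom_proj]
    have h2 := Matrix.mul_adjugate E
    have key (a : Fin 2) : (E a 0 : ℝ) * (E.adjugate 0 j / E.det) + E a 1 * (E.adjugate 1 j / E.det)
        = (((1 : Matrix (Fin 2) (Fin 2) ℤ) a j : ℤ) : ℝ) := by
      have h3 := congrFun (congrFun h2 a) j
      rw [Matrix.mul_apply, Fin.sum_univ_two, Matrix.smul_apply, smul_eq_mul] at h3
      have h4 : (E a 0 : ℝ) * E.adjugate 0 j + E a 1 * E.adjugate 1 j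
        = E.det * (((1 : Matrix (Fin 2) (Fin 2) ℤ) a j : ℤ) : ℝ) := by exact_mod_cast h3
      field_simp
      linarith
    unfold proj
    rw [matCLM_apply, matCLM_apply]
    have e0 : (!₂[(E.adjugate 0 j : ℝ) / E.det, (E.adjugate 1 j : ℝ) / E.det] : V2) 0
      = E.adjugate 0 j / E.det := rfl
    have e1 : (!₂[(E.adjugate 0 j : ℝ) / E.det, (E.adjugate 1 j : ℝ) / E.det] : V2) 1
      = E.adjugate 1 j / E.det := rfl
    rw [e0, e1, key, key, hcoe, hcoe]
    rfl
  · rw [coord_proj]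
    have e : (!₂[(E.adjugate 0 j : ℝ) / E.det, (E.adjugate 1 j : ℝ) / E.det] : V2) i
      = E.adjugate i j / E.det := by fin_cases i <;> rfl
    rw [e]
    intro h
    rw [AddCircle.coe_eq_zero_iff] at h
    obtain ⟨n, hn⟩ := h
    apply hij
    refine ⟨n, ?_⟩
    simp only [zsmul_eq_mul, mul_one] at hn
    rw [eq_div_iff hd'] at hn
    rw [mul_comm]
    exact_mod_cast hn.symm

lemma ker_integral {E : Matrix (Fin 2) (Fin 2) ℤ} {i : Fin 2} {k : T2}
    (hk : torusHom E k = 0) (hki : coord i k ≠ 0) {B : Set T2} (hB : MeasurableSet B) :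
    ∫ x in torusHom E ⁻¹' B, (AddCircle.toCircle (coord i x) : ℂ) = 0 := by
  have hS : MeasurableSet (torusHom E ⁻¹' B) := (torusHom_continuous E).measurable hB
  rw [← integral_indicator hS]
  set F := (torusHom E ⁻¹' B).indicator fun x => (AddCircle.toCircle (coord i x) : ℂ) with hF
  have h1 : ∀ x, F (x + k) = (AddCircle.toCircle (coord i k) : ℂ) * F x := by
    intro x
    have : (x + k ∈ torusHom E ⁻¹' B) ↔ (x ∈ torusHom E ⁻¹' B) := by
      simp [map_add, hk]
    by_cases hx : x ∈ torusHom E ⁻¹' B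
    · rw [hF, indicator_of_mem hx, indicator_of_mem (this.2 hx), coord_add, AddCircle.toCircle_add]
      push_cast; ring
    · rw [hF, indicator_of_notMem hx, indicator_of_notMem (mt this.1 hx), mul_zero]
  have h2 : ∫ x, F (x + k) = ∫ x, F x := integral_add_right_eq_self F k
  simp_rw [h1] at h2
  rw [integral_const_mul] at h2
  have h3 : (AddCircle.toCircle (coord i k) : ℂ) ≠ 1 := by
    intro h
    apply hki
    apply AddCircle.injective_toCircle (one_ne_zero)
    rw [AddCircle.toCircle_zero]
    exact Subtype.ext h
  have h4 : ((AddCircle.toCircle (coord i k) : ℂ) - 1) * ∫ x, F x = 0 := by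
    rw [sub_mul, h2]; ring
  exact (mul_eq_zero.1 h4).resolve_left (sub_ne_zero.2 h3)

lemma ker_lintegral {E : Matrix (Fin 2) (Fin 2) ℤ} (hE : E.det ≠ 0) {i : Fin 2} {k : T2}
    (hk : torusHom E k = 0) (hki : coord i k ≠ 0) {η : ℝ} (hη : 0 < η) (hη' : η ≤ 1 / 2)
    {B : Set T2} (hB : MeasurableSet B) :
    ∫⁻ x in torusHom E ⁻¹' B, ENNReal.ofReal (wden η (coord i x)) = volume B := by
  have hc : Continuous fun x : T2 => (AddCircle.toCircle (coord i x) : ℂ) := by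
    have := (AddCircle.continuous_toCircle (T := (1 : ℝ))).comp (coord_continuous i)
    exact continuous_subtype_val.comp this
  have hi : Integrable (fun x : T2 => (AddCircle.toCircle (coord i x) : ℂ))
      (volume.restrict (torusHom E ⁻¹' B)) := by
    refine Integrable.of_bound hc.aestronglyMeasurable 1 (Filter.Eventually.of_forall fun x => ?_)
    exact (Circle.norm_coe _).le
  have hi2 : Integrable (fun x : T2 => (AddCircle.toCircle (coord i x) : ℂ).re)
      (volume.restrict (torusHom E ⁻¹' B)) := hi.re
  have hi3 : Integrable (fun x : T2 => wden η (coord i x))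
      (volume.restrict (torusHom E ⁻¹' B)) := (integrable_const 1).add (hi2.const_mul η)
  have hpos : ∀ x : T2, 0 ≤ wden η (coord i x) := by
    intro x
    obtain ⟨p, rfl⟩ := proj_surjective x
    rw [coord_proj, wden_coe]
    linarith [psi_deriv_pos hη hη' (2 * Real.pi * p i)]
  rw [← ofReal_integral_eq_lintegral_ofReal hi3 (Filter.Eventually.of_forall hpos)]
  have hre : ∫ x in torusHom E ⁻¹' B, (AddCircle.toCircle (coord i x) : ℂ).re = 0 := by
    have : ∫ x in torusHom E ⁻¹' B, (AddCircle.toCircle (coord i x) : ℂ).re =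
      (∫ x in torusHom E ⁻¹' B, (AddCircle.toCircle (coord i x) : ℂ)).re := integral_re hi
    rw [this, ker_integral hk hki hB]; rfl
  have : ∫ x in torusHom E ⁻¹' B, wden η (coord i x) =
      (volume (torusHom E ⁻¹' B)).toReal := by
    unfold wden
    rw [integral_add (integrable_const 1) (hi2.const_mul η), integral_const_mul, hre]
    simp [Measure.real]
  rw [this, ENNReal.ofReal_toReal (measure_ne_top _ _), (torusHom_mp hE).measure_preimage
    hB.nullMeasurableSet]

/-- The perturbation acting on coordinate `i`. -/
def pert (i : Fin 2) (φ : AddCircle (1 : ℝ) → AddCircle (1 : ℝ)) : T2 → T2 :=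
  if i = 0 then Prod.map φ id else Prod.map id φ

lemma pert_measurable (i : Fin 2) {φ : AddCircle (1 : ℝ) → AddCircle (1 : ℝ)} (h : Measurable φ) :
    Measurable (pert i φ) := by
  unfold pert
  split_ifs
  · exact h.prodMap measurable_id
  · exact measurable_id.prodMap h

lemma pert_map (i : Fin 2) {φ : AddCircle (1 : ℝ) → AddCircle (1 : ℝ)} (h : Measurable φ)
    {w : AddCircle (1 : ℝ) → ℝ≥0∞} (hw : Measurable w)
    (hφ : Measure.map φ volume = (volume : Measure (AddCircle (1 : ℝ))).withDensity w) :
    Measure.map (pert i φ) volume = (volume : Measure T2).withDensity (fun x => w (coord i x)) := by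
  have : IsFiniteMeasure ((volume : Measure (AddCircle (1 : ℝ))).withDensity w) := by
    rw [← hφ]; infer_instance
  unfold pert coord
  rw [Measure.volume_eq_prod]
  split_ifs
  · rw [← Measure.map_prod_map _ _ h measurable_id, hφ, Measure.map_id, prod_withDensity_left hw]
  · rw [← Measure.map_prod_map _ _ measurable_id h, hφ, Measure.map_id, prod_withDensity_right hw]

lemma g_preserves {E : Matrix (Fin 2) (Fin 2) ℤ} (hE : E.det ≠ 0) {i : Fin 2} {k : T2}
    (hk : torusHom E k = 0) (hki : coord i k ≠ 0) {η : ℝ} (hη : 0 < η) (hη' : η ≤ 1 / 2)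
    {φ : AddCircle (1 : ℝ) → AddCircle (1 : ℝ)} (h : Measurable φ)
    (hφ : Measure.map φ volume =
      (volume : Measure (AddCircle (1 : ℝ))).withDensity (fun x => ENNReal.ofReal (wden η x)))
    {B : Set T2} (hB : MeasurableSet B) :
    volume ((fun x => torusHom E (pert i φ x)) ⁻¹' B) = volume B := by
  have hS : MeasurableSet (torusHom E ⁻¹' B) := (torusHom_continuous E).measurable hB
  have : (fun x => torusHom E (pert i φ x)) ⁻¹' B = pert i φ ⁻¹' (torusHom E ⁻¹' B) := rfl
  rw [this, ← Measure.map_apply (pert_measurable i h) hS,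
    pert_map i h (wden_continuous η).measurable.ennreal_ofReal hφ, withDensity_apply _ hS,
    ker_lintegral hE hk hki hη hη' hB]

lemma exists_phi {τ : ℝ → ℝ} (hc : Continuous τ) (hτ : ∀ t, τ (t + 1) = τ t + 1) :
    ∃ φ : AddCircle (1 : ℝ) → AddCircle (1 : ℝ), Measurable φ ∧
      ∀ t : ℝ, φ (t : AddCircle (1 : ℝ)) = ((τ t : ℝ) : AddCircle (1 : ℝ)) := by
  have hp : Function.Periodic (fun t : ℝ => ((τ t : ℝ) : AddCircle (1 : ℝ))) 1 := by
    intro t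
    simp only [hτ]
    rw [AddCircle.coe_add, AddCircle.coe_period, add_zero]
  refine ⟨hp.lift, ?_, fun t => hp.lift_coe t⟩
  apply Continuous.measurable
  refine (QuotientAddGroup.isQuotientMap_mk _).continuous_iff.2 ?_
  exact (AddCircle.continuous_mk' 1).comp hc

lemma tau_add_int {τ : ℝ → ℝ} (hτ : ∀ t, τ (t + 1) = τ t + 1) (t : ℝ) (n : ℤ) :
    τ (t + n) = τ t + n := by
  have hp : Function.Periodic (fun t : ℝ => τ t - t) 1 := by
    intro t
    simp only [hτ]; ring
  have := hp.int_mul n t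
  simp only [mul_one] at this
  linarith

/-- basis vector -/
def ee (i : Fin 2) : V2 := EuclideanSpace.single i (1 : ℝ)

/-- coordinate functional -/
def cc (i : Fin 2) : V2 →L[ℝ] ℝ := EuclideanSpace.proj i

lemma cc_apply (i : Fin 2) (p : V2) : cc i p = p i := rfl

lemma pert_proj {τ : ℝ → ℝ} {φ : AddCircle (1 : ℝ) → AddCircle (1 : ℝ)}
    (hφ : ∀ t : ℝ, φ (t : AddCircle (1 : ℝ)) = ((τ t : ℝ) : AddCircle (1 : ℝ)))
    (i : Fin 2) (p : V2) :
    pert i φ (proj p) = proj (p + (τ (cc i p) - cc i p) • ee i) := by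
  fin_cases i <;> simp [pert, proj, hφ, ee, cc_apply]

lemma matCLM_iv (E : Matrix (Fin 2) (Fin 2) ℤ) (m : Fin 2 → ℤ) :
    matCLM E (iv m) = iv (E.mulVec m) := by
  ext i
  rw [matCLM_apply]
  simp [iv, Matrix.mulVec, dotProduct, Fin.sum_univ_two]

lemma dist_proj_le (a b : V2) : dist (proj a) (proj b) ≤ ‖a - b‖ := by
  have h (i : Fin 2) : dist ((a i : ℝ) : AddCircle (1 : ℝ)) ((b i : ℝ) : AddCircle (1 : ℝ))
      ≤ ‖a - b‖ := by
    rw [dist_eq_norm, ← AddCircle.coe_sub]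
    refine le_trans (QuotientAddGroup.norm_mk_le_norm) ?_
    exact PiLp.norm_apply_le (a - b) i
  exact max_le (h 0) (h 1)

lemma det_shear (i : Fin 2) (c : ℝ) :
    LinearMap.det ((ContinuousLinearMap.id ℝ V2 + c • (cc i).smulRight (ee i) : V2 →L[ℝ] V2)
      : V2 →ₗ[ℝ] V2) = 1 + c := by
  rw [← LinearMap.det_toMatrix (EuclideanSpace.basisFun (Fin 2) ℝ).toBasis, Matrix.det_fin_two]
  simp only [LinearMap.toMatrix_apply]
  fin_cases i <;> simp [ee, cc_apply]

lemma det_matCLM (E : Matrix (Fin 2) (Fin 2) ℤ) :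
    LinearMap.det (matCLM E : V2 →ₗ[ℝ] V2) = (E.det : ℝ) := by
  rw [← LinearMap.det_toMatrix (EuclideanSpace.basisFun (Fin 2) ℝ).toBasis, Matrix.det_fin_two,
    Matrix.det_fin_two]
  simp [LinearMap.toMatrix_apply, matCLM_apply]

lemma norm_shear (i : Fin 2) : ‖(cc i).smulRight (ee i)‖ ≤ 1 := by
  refine ContinuousLinearMap.opNorm_le_bound _ zero_le_one fun p => ?_
  rw [ContinuousLinearMap.smulRight_apply, norm_smul, one_mul]
  simp only [ee, PiLp.norm_single, norm_one, mul_one]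
  exact PiLp.norm_apply_le p i

/-- The lift. -/
def liftG (E : Matrix (Fin 2) (Fin 2) ℤ) (i : Fin 2) (τ : ℝ → ℝ) (p : V2) : V2 :=
  matCLM E (p + (τ (cc i p) - cc i p) • ee i)

lemma liftG_fderiv (E : Matrix (Fin 2) (Fin 2) ℤ) (i : Fin 2) {τ : ℝ → ℝ} {p : V2} {c : ℝ}
    (h : HasDerivAt τ c (cc i p)) :
    fderiv ℝ (liftG E i τ) p =
      (matCLM E).comp (ContinuousLinearMap.id ℝ V2 + (c - 1) • (cc i).smulRight (ee i)) := by
  apply HasFDerivAt.fderiv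
  have h1 : HasDerivAt (fun t => τ t - t) (c - 1) (cc i p) := h.sub (hasDerivAt_id _)
  have h2 := h1.comp_hasFDerivAt p (cc i).hasFDerivAt
  have h3 := (hasFDerivAt_id (𝕜 := ℝ) p).add (h2.smul_const (ee i))
  have h4 := (matCLM E).hasFDerivAt.comp p h3
  refine h4.congr_fderiv ?_
  ext q
  simp [smul_smul]

/-- For every integer matrix `E` with `|det E| ≥ 2` and every `ε > 0`
there is a `C^∞` local diffeomorphism `g` of `𝕋²` (encoded by a lift `G : ℝ² → ℝ²`)
homotopic to the linear endomorphism induced by `E` (i.e. with linear part `E`), preserving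
Haar measure, with nonconstant Jacobian (`|det Dg_p| ≠ |det E|` at some point), and
`C¹`-`ε`-close to `E`. -/
theorem exists_conservative_nonconstant_jacobian_torus_endo
    (E : Matrix (Fin 2) (Fin 2) ℤ) (hE : 2 ≤ E.det.natAbs) (ε : ℝ) (hε : 0 < ε) :
    ∃ (G : V2 → V2) (g : T2 → T2) (LE : T2 → T2),
      ContDiff ℝ (⊤ : ℕ∞) G ∧
      (∀ (p : V2) (m : Fin 2 → ℤ), G (p + iv m) = G p + iv (E.mulVec m)) ∧
      (∀ p : V2, g (proj p) = proj (G p)) ∧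
      (∀ p : V2, LE (proj p) = proj (matCLM E p)) ∧
      (∀ p : V2, IsUnit (fderiv ℝ G p)) ∧
      (∀ B : Set T2, MeasurableSet B → volume (g ⁻¹' B) = volume B) ∧
      (∃ p : V2, |LinearMap.det (fderiv ℝ G p : V2 →ₗ[ℝ] V2)| ≠ |(E.det : ℝ)|) ∧
      (∀ x : T2, dist (g x) (LE x) < ε) ∧
      (∀ p : V2, ‖fderiv ℝ G p - matCLM E‖ < ε) := by
  have hd : E.det ≠ 0 := by intro h; simp [h] at hE
  have hd' : (E.det : ℝ) ≠ 0 := by exact_mod_cast hd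
  obtain ⟨i, k, hk, hki⟩ := exists_ker E hE
  have hM : 0 < 4 * (‖matCLM E‖ + 1) := by positivity
  obtain ⟨η, h0, h1, hηε⟩ : ∃ η : ℝ, 0 < η ∧ η ≤ 1 / 2 ∧ η * (4 * (‖matCLM E‖ + 1)) ≤ ε := by
    refine ⟨min (1 / 2) (ε / (4 * (‖matCLM E‖ + 1))), by positivity, min_le_left _ _, ?_⟩
    rw [← le_div_iff₀ hM]
    exact min_le_right _ _
  have hsmall : 2 * η * ‖matCLM E‖ < ε := by nlinarith [norm_nonneg (matCLM E)]
  obtain ⟨τ, hc, hr, hl, hτ1, hτd⟩ := exists_tau h0 h1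
  obtain ⟨φ, hφm, hφ⟩ := exists_phi hc.continuous hτ1
  have hpos : ∀ t, 1 / 2 ≤ 1 + η * Real.cos (2 * Real.pi * t) := fun t => psi_deriv_pos h0 h1 _
  have hdet : ∀ p : V2, LinearMap.det (fderiv ℝ (liftG E i τ) p : V2 →ₗ[ℝ] V2) =
      E.det * (1 + η * Real.cos (2 * Real.pi * τ (cc i p)))⁻¹ := by
    intro p
    rw [liftG_fderiv E i (hτd _), ContinuousLinearMap.toLinearMap_comp, LinearMap.det_comp,
      det_matCLM, det_shear]
    ring
  refine ⟨liftG E i τ, fun x => torusHom E (pert i φ x), torusHom E, ?_, ?_, ?_,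
    torusHom_proj E, ?_, ?_, ?_, ?_, ?_⟩
  · unfold liftG
    fun_prop
  · intro p m
    have hm : cc i (p + iv m) = cc i p + m i := rfl
    unfold liftG
    rw [hm, tau_add_int hτ1, ← matCLM_iv, ← map_add]
    congr 1
    rw [add_sub_add_right_eq_sub]
    abel
  · intro p
    simp only
    rw [pert_proj hφ, torusHom_proj]; rfl
  · intro p
    rw [ContinuousLinearMap.isUnit_iff_bijective]
    have h2 : IsUnit (LinearMap.det (fderiv ℝ (liftG E i τ) p : V2 →ₗ[ℝ] V2)) := by
      rw [hdet, isUnit_iff_ne_zero]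
      have := hpos (τ (cc i p))
      exact mul_ne_zero hd' (inv_ne_zero (by linarith))
    have h5 := (LinearMap.isUnit_iff_isUnit_det _).2 h2
    exact (Module.End.isUnit_iff _).1 h5
  · intro B hB
    exact g_preserves hd hk hki h0 h1 hφm (circle_map h0 h1 hr hl hφm hφ) hB
  · refine ⟨0, ?_⟩
    rw [hdet, map_zero]
    have : τ 0 = 0 := by
      have := hl 0
      rwa [show psi η 0 = 0 by simp [psi]] at this
    rw [this, mul_zero, Real.cos_zero, mul_one, abs_mul]
    intro h
    have h3 := mul_left_cancel₀ (abs_ne_zero.2 hd') (h.trans (mul_one _).symm)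
    rw [abs_of_pos (by positivity), inv_eq_one] at h3
    linarith
  · intro x
    obtain ⟨p, rfl⟩ := proj_surjective x
    show dist (torusHom E (pert i φ (proj p))) _ < ε
    rw [pert_proj hφ, torusHom_proj, torusHom_proj]
    refine lt_of_le_of_lt (dist_proj_le _ _) ?_
    rw [← map_sub, add_sub_cancel_left]
    have h3 : |τ (cc i p) - cc i p| ≤ η := by
      have := psi_sub_le h0 (τ (cc i p))
      rwa [hr, abs_sub_comm] at this
    have h4 : ‖(τ (cc i p) - cc i p) • ee i‖ ≤ η := by
      rw [norm_smul, Real.norm_eq_abs]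
      simpa [ee] using h3
    calc _ ≤ ‖matCLM E‖ * ‖(τ (cc i p) - cc i p) • ee i‖ := (matCLM E).le_opNorm _
      _ ≤ ‖matCLM E‖ * η := by gcongr
      _ < ε := by nlinarith [norm_nonneg (matCLM E)]
  · intro p
    rw [liftG_fderiv E i (hτd _)]
    have h2 := hpos (τ (cc i p))
    set C := Real.cos (2 * Real.pi * τ (cc i p)) with hC
    have h3 : |(1 + η * C)⁻¹ - 1| ≤ 2 * η := by
      have hne : 1 + η * C ≠ 0 := by linarith
      have : (1 + η * C)⁻¹ - 1 = -(η * C) / (1 + η * C) := by field_simp; ring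
      rw [this, abs_div, abs_neg, abs_mul, abs_of_pos h0, abs_of_pos (a := 1 + η * C) (by linarith),
        div_le_iff₀ (by linarith)]
      have := Real.abs_cos_le_one (2 * Real.pi * τ (cc i p))
      rw [← hC] at this
      nlinarith
    have h4 : (matCLM E).comp (ContinuousLinearMap.id ℝ V2 +
        ((1 + η * C)⁻¹ - 1) • (cc i).smulRight (ee i)) - matCLM E =
        (matCLM E).comp (((1 + η * C)⁻¹ - 1) • (cc i).smulRight (ee i)) := by
      rw [ContinuousLinearMap.comp_add, ContinuousLinearMap.comp_id, add_sub_cancel_left]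
    rw [h4]
    calc _ ≤ ‖matCLM E‖ * ‖((1 + η * C)⁻¹ - 1) • (cc i).smulRight (ee i)‖ :=
          ContinuousLinearMap.opNorm_comp_le _ _
      _ ≤ ‖matCLM E‖ * (2 * η * 1) := by
          gcongr
          rw [norm_smul, Real.norm_eq_abs]
          exact mul_le_mul h3 (norm_shear i) (norm_nonneg _) (by positivity)
      _ < ε := by linarith

end
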